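/- Let f = f̃ ∘ h with f̃, h ∈ ℂ[X], 1 < deg h = d < m = deg f, f monic. Work in the Galois framework: L is a splitting field of f(X) − t over K = ℂ(t), G = Gal(L/K), the m distinct roots z_1,…,z_m ∈ L are numbered so that some σ_∞ ∈ G satisfies σ_∞(z_i) = z_{i+1 (mod m)}. Let C = (n_1,…,n_m) ∈ ℤ^m be a balanced 0-cycle of f. Assume the critical values of f̃ and h do not merge, and assume h is 2-transitive. Let s_0,…,s_{d−1} be the power sums of the roots of h(X) − w (independent of w). Then for any g_0,…,g_{d−1} ∈ ℂ[X] and g(X) = ∑_{i=0}^{d−1} X^i · g_i(h(X)): ∑_{j=1}^m n_j g(z_j) = 0 in L if and only if ∑_{j=1}^m n_j g̃(h(z_j)) = 0 in L, where g̃ = ∑_{i=0}^{d−1} s_i g_i ∈ ℂ[X] (the latter sum is the abelian integral of g̃ along the projected cycle h(C) of f̃). -/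

import Mathlib

open Polynomial

/-- The polynomial `u(X) - t` over the field of rational functions `ℂ(t)`. -/
noncomputable def fiberPoly (u : Polynomial ℂ) : Polynomial (RatFunc ℂ) :=
  u.map (algebraMap ℂ (RatFunc ℂ)) - Polynomial.C RatFunc.X

/-- A polynomial `u ∈ ℂ[X]` is 2-transitive if the Galois group of `u(X) - t` over `ℂ(t)`
acts 2-transitively on the roots of `u(X) - t` in a splitting field. -/
def IsTwoTransitivePoly (u : Polynomial ℂ) : Prop :=
  ∀ x y x' y' : (fiberPoly u).SplittingField,
    x ∈ (fiberPoly u).aroots (fiberPoly u).SplittingField →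
    y ∈ (fiberPoly u).aroots (fiberPoly u).SplittingField →
    x' ∈ (fiberPoly u).aroots (fiberPoly u).SplittingField →
    y' ∈ (fiberPoly u).aroots (fiberPoly u).SplittingField →
    x ≠ y → x' ≠ y' →
    ∃ σ : (fiberPoly u).SplittingField ≃ₐ[RatFunc ℂ] (fiberPoly u).SplittingField,
      σ x = x' ∧ σ y = y'

/-- The critical values of `f̃` and `h` do not merge in the composition `f = f̃ ∘ h`. -/
def CriticalValuesDoNotMerge (ftilde h : Polynomial ℂ) : Prop :=
  (¬ ∃ a b : ℂ, (Polynomial.derivative ftilde).eval (h.eval a) = 0 ∧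
      (Polynomial.derivative h).eval b = 0 ∧
      (ftilde.comp h).eval a = (ftilde.comp h).eval b) ∧
  (∀ b b' : ℂ, (Polynomial.derivative h).eval b = 0 →
      (Polynomial.derivative h).eval b' = 0 →
      ftilde.eval (h.eval b) = ftilde.eval (h.eval b') → h.eval b = h.eval b')

theorem exists_ne_one_inertia (A K L B : Type*) [CommRing A] [IsDedekindDomain A] [Field K]
    [Algebra A K] [IsFractionRing A K] [Field L] [Algebra K L] [Algebra A L]
    [IsScalarTower A K L] [CommRing B] [Algebra A B] [Algebra B L] [IsScalarTower A B L]
    [IsIntegralClosure B A L] [FiniteDimensional K L] [IsGalois K L]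
    (p : Ideal A) [p.IsPrime] (hp : p ≠ ⊥) [PerfectField p.ResidueField]
    (P : Ideal B) [P.IsPrime] [P.LiesOver p] (hP : p.map (algebraMap A B) ≤ P ^ 2) :
    ∃ σ : L ≃ₐ[K] L, σ ≠ 1 ∧
      ∀ x y : B, algebraMap B L y = σ (algebraMap B L x) → y - x ∈ P := by
  have : IsDomain B :=
    (IsIntegralClosure.equiv A B L (integralClosure A L)).toMulEquiv.isDomain (integralClosure A L)
  have := IsIntegralClosure.isDedekindDomain A K L B
  have : Module.Finite A B := IsIntegralClosure.finite A K L B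
  have : IsFractionRing B L := IsIntegralClosure.isFractionRing_of_finite_extension A K L B
  let : MulSemiringAction Gal(L/K) B := IsIntegralClosure.MulSemiringAction A K L B
  have : IsGaloisGroup Gal(L/K) A B := IsGaloisGroup.of_isFractionRing _ _ _ K L
  have : Module.IsTorsionFree A L := Module.IsTorsionFree.trans_faithfulSMul A K L
  have : Module.IsTorsionFree A B := by
    have hinj : Function.Injective (algebraMap A B) := by
      have h : Function.Injective (algebraMap A L) := FaithfulSMul.algebraMap_injective A L
      rw [IsScalarTower.algebraMap_eq A B L] at h
      exact Function.Injective.of_comp h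
    exact (Module.isTorsionFree_iff_algebraMap_injective).2 hinj
  have hpB : p.map (algebraMap A B) ≠ ⊥ := Ideal.map_ne_bot_of_ne_bot hp
  have hcard : Nat.card (P.inertia Gal(L/K)) ≠ 1 := by
    rw [Ideal.card_inertia_eq_ramificationIdxIn p P,
      Ideal.ramificationIdxIn_eq_ramificationIdx p P Gal(L/K),
      Ideal.IsDedekindDomain.ramificationIdx_eq_multiplicity p P hpB]
    have hfin : FiniteMultiplicity P (p.map (algebraMap A B)) := by
      refine FiniteMultiplicity.of_not_isUnit ?_ hpB
      rw [Ideal.isUnit_iff]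
      exact Ideal.IsPrime.ne_top'
    have := (hfin.pow_dvd_iff_le_multiplicity (k := 2)).1 (Ideal.dvd_iff_le.2 hP)
    omega
  have hne : P.inertia Gal(L/K) ≠ ⊥ := fun h ↦ hcard (by rw [h]; simp)
  obtain ⟨σ, hσ1⟩ := Subgroup.ne_bot_iff_exists_ne_one.1 hne
  refine ⟨σ, fun h ↦ hσ1 (Subtype.ext h), fun x y hxy ↦ ?_⟩
  have := σ.2 x
  have e : σ.1 • x = y := by
    apply FaithfulSMul.algebraMap_injective B L
    rw [hxy]
    exact algebraMap_galRestrict_apply A σ.1 x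
  rwa [← e]

theorem eval_derivative_eq_zero_of_sub_mem {B : Type*} [CommRing B] [IsDomain B] [Algebra ℂ B]
    (P : Ideal B) [P.IsPrime] (p : ℂ[X]) {x y : B} {c : ℂ} (hne : x ≠ y)
    (hp : aeval x p = aeval y p) (hxy : x - y ∈ P) (hc : y - algebraMap ℂ B c ∈ P) :
    p.derivative.eval c = 0 := by
  obtain ⟨k, hk⟩ := (p.map (algebraMap ℂ B)).binomExpansion y (x - y)
  rw [add_sub_cancel, eval_map_algebraMap, eval_map_algebraMap, derivative_map,
    eval_map_algebraMap, hp] at hk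
  have h1 : aeval y (derivative p) + k * (x - y) = 0 := by
    refine (mul_eq_zero.1 ?_).resolve_right (sub_ne_zero.2 hne)
    linear_combination -hk
  have h2 : aeval y (derivative p) ∈ P := by
    rw [eq_neg_of_add_eq_zero_left h1]
    exact P.neg_mem (P.mul_mem_left _ hxy)
  obtain ⟨q, hq⟩ := ((derivative p).map (algebraMap ℂ B)).evalSubFactor y (algebraMap ℂ B c)
  rw [eval_map_algebraMap, eval_map_algebraMap, aeval_algebraMap_apply] at hq
  have h3 : algebraMap ℂ B (aeval c (derivative p)) ∈ P := by
    have := P.sub_mem h2 (P.mul_mem_left q hc)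
    rwa [← hq, sub_sub_cancel] at this
  by_contra hcon
  rw [coe_aeval_eq_eval] at h3
  exact Ideal.IsPrime.ne_top' (P.eq_top_of_isUnit_mem h3 ((IsUnit.mk0 _ hcon).map (algebraMap ℂ B)))

theorem exists_eval_eq_of_aeval_sub_mem {B : Type*} [CommRing B] [Algebra ℂ B]
    (P : Ideal B) [P.IsPrime] (p : ℂ[X]) (hp : 0 < p.natDegree) {x : B} {t : ℂ}
    (h : aeval x p - algebraMap ℂ B t ∈ P) :
    ∃ c : ℂ, p.eval c = t ∧ x - algebraMap ℂ B c ∈ P := by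
  have hne : p - C t ≠ 0 := fun h0 ↦ by
    rw [sub_eq_zero.1 h0, natDegree_C] at hp
    exact hp.false
  have hs := (IsAlgClosed.splits (p - C t)).eq_prod_roots
  have h1 : aeval x (p - C t) ∈ P := by simpa using h
  rw [hs, map_mul, aeval_C, map_multiset_prod, Multiset.map_map] at h1
  have h2 := (Ideal.IsPrime.mem_or_mem ‹_› h1).resolve_left fun h ↦
    Ideal.IsPrime.ne_top' (P.eq_top_of_isUnit_mem h
      ((IsUnit.mk0 _ (leadingCoeff_ne_zero.2 hne)).map (algebraMap ℂ B)))
  rw [Ideal.IsPrime.multiset_prod_mem_iff_exists_mem ‹_›] at h2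
  obtain ⟨_, hr, hcP⟩ := h2
  obtain ⟨c, hc, rfl⟩ := Multiset.mem_map.1 hr
  refine ⟨c, ?_, by simpa using hcP⟩
  have := (mem_roots hne).1 hc
  simpa [sub_eq_zero] using this

theorem exists_automorphism_moving_one_fiber {L : Type*} [Field L] [Algebra ℂ L]
    [Algebra (RatFunc ℂ) L] [IsScalarTower ℂ (RatFunc ℂ) L] [FiniteDimensional (RatFunc ℂ) L]
    [IsGalois (RatFunc ℂ) L] {m : ℕ} (ftilde h : ℂ[X]) (hf : (ftilde.comp h).Monic)
    (hdeg : 1 < h.natDegree) (hfdeg : 0 < (ftilde.comp h).natDegree)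
    (hmerge : CriticalValuesDoNotMerge ftilde h) (z : Fin m → L)
    (hprod : (ftilde.comp h).map (algebraMap ℂ L) - C (algebraMap (RatFunc ℂ) L RatFunc.X) =
      ∏ i, (X - C (z i))) :
    ∃ τ : L ≃ₐ[RatFunc ℂ] L, τ ≠ 1 ∧ ∃ j₀, ∀ j, aeval (z j) h ≠ aeval (z j₀) h →
      τ (z j) = z j := by
  obtain ⟨b, hb⟩ : ∃ b, (derivative h).eval b = 0 := by
    refine IsAlgClosed.exists_root _ ?_
    rw [degree_eq_natDegree, natDegree_derivative]
    · norm_cast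
      omega
    · intro h0
      have := natDegree_derivative h
      rw [h0, natDegree_zero] at this
      omega
  set f := ftilde.comp h with hfdef
  set t₀ := f.eval b with ht₀
  let _ : Algebra ℂ[X] L :=
    ((algebraMap (RatFunc ℂ) L).comp (algebraMap ℂ[X] (RatFunc ℂ))).toAlgebra
  have : IsScalarTower ℂ[X] (RatFunc ℂ) L := .of_algebraMap_eq' rfl
  have : IsScalarTower ℂ ℂ[X] L := .of_algebraMap_eq fun a ↦ by
    rw [IsScalarTower.algebraMap_apply ℂ[X] (RatFunc ℂ) L,
      ← IsScalarTower.algebraMap_apply ℂ ℂ[X] (RatFunc ℂ), ← IsScalarTower.algebraMap_apply]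
  have ht : algebraMap ℂ[X] L X = algebraMap (RatFunc ℂ) L RatFunc.X := by
    rw [IsScalarTower.algebraMap_apply ℂ[X] (RatFunc ℂ) L, RatFunc.algebraMap_X]
  rw [← ht] at hprod
  let B := integralClosure ℂ[X] L
  have hroot : ∀ i, aeval (z i) f = algebraMap ℂ[X] L X := fun i ↦ by
    have := congrArg (eval (z i)) hprod
    rw [eval_prod, Finset.prod_eq_zero (Finset.mem_univ i) (by simp), eval_sub, eval_C,
      eval_map_algebraMap] at this
    exact sub_eq_zero.1 this
  have hzint : ∀ i, IsIntegral ℂ[X] (z i) := fun i ↦ by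
    refine ⟨f.map C - C X, (hf.map C).sub_of_left ?_, ?_⟩
    · rw [hf.degree_map, degree_eq_natDegree hf.ne_zero]
      exact degree_C_le.trans_lt (by exact_mod_cast hfdeg)
    · have : eval₂ (algebraMap ℂ[X] L) (z i) (f.map C) = aeval (z i) f := by
        rw [eval₂_map, aeval_def, IsScalarTower.algebraMap_eq ℂ ℂ[X] L]
        rfl
      rw [eval₂_sub, eval₂_C, this, hroot, sub_self]
  let y : Fin m → B := fun i ↦ ⟨z i, hzint i⟩
  have hy : ∀ i (p : ℂ[X]), ((aeval (y i) p : B) : L) = aeval (z i) p := fun i p ↦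
    (aeval_algebraMap_apply L (y i) p).symm
  have hyroot : ∀ i, aeval (y i) f = algebraMap ℂ[X] B X := fun i ↦
    Subtype.ext ((hy i f).trans (hroot i))
  let p : Ideal ℂ[X] := Ideal.span {X - C t₀}
  have hpprime : p.IsPrime :=
    (Ideal.span_singleton_prime (X_sub_C_ne_zero t₀)).2 (prime_X_sub_C t₀)
  have hpbot : p ≠ ⊥ := by simpa [p, Ideal.span_singleton_eq_bot] using X_sub_C_ne_zero t₀
  have : CharZero p.ResidueField :=
    charZero_of_injective_ringHom
      ((algebraMap ℂ[X] p.ResidueField).comp (C : ℂ →+* ℂ[X])).injective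
  have hinj : Function.Injective (algebraMap ℂ[X] B) := by
    have h : Function.Injective (algebraMap ℂ[X] L) := by
      rw [IsScalarTower.algebraMap_eq ℂ[X] (RatFunc ℂ) L]
      exact (algebraMap (RatFunc ℂ) L).injective.comp (IsFractionRing.injective ℂ[X] (RatFunc ℂ))
    rw [IsScalarTower.algebraMap_eq ℂ[X] B L, RingHom.coe_comp] at h
    exact Function.Injective.of_comp h
  have : FaithfulSMul ℂ[X] B := (faithfulSMul_iff_algebraMap_injective _ _).2 hinj
  have : Algebra.IsIntegral ℂ[X] B := integralClosure.AlgebraIsIntegral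
  obtain ⟨⟨P, hPp, hPl⟩⟩ := (inferInstance : Nonempty (p.primesOver B))
  have htP : algebraMap ℂ[X] B X - algebraMap ℂ B t₀ ∈ P := by
    have : X - C t₀ ∈ P.under ℂ[X] := by
      rw [← hPl.over]
      exact Ideal.mem_span_singleton_self _
    simpa [Ideal.under, IsScalarTower.algebraMap_apply ℂ ℂ[X] B] using this
  obtain ⟨j₀, hj₀⟩ : ∃ j₀, y j₀ - algebraMap ℂ B b ∈ P := by
    have h1 : algebraMap ℂ B t₀ - algebraMap ℂ[X] B X = ∏ i, (algebraMap ℂ B b - y i) := by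
      apply Subtype.ext
      have := congrArg (eval (algebraMap ℂ L b)) hprod
      rw [eval_prod, eval_sub, eval_C, eval_map_algebraMap, aeval_algebraMap_apply,
        coe_aeval_eq_eval] at this
      simpa using this
    have h2 : ∏ i, (algebraMap ℂ B b - y i) ∈ P := by
      rw [← h1, ← neg_sub]
      exact P.neg_mem htP
    obtain ⟨i, -, hi⟩ := (Ideal.IsPrime.prod_mem_iff).1 h2
    exact ⟨i, by rw [← neg_sub]; exact P.neg_mem hi⟩
  have hfb : (derivative f).eval b = 0 := by
    rw [hfdef, derivative_comp, eval_mul, hb, zero_mul]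
  have hP2 : p.map (algebraMap ℂ[X] B) ≤ P ^ 2 := by
    rw [Ideal.map_span, Set.image_singleton, Ideal.span_singleton_le_iff_mem]
    obtain ⟨k, hk⟩ := (f.map (algebraMap ℂ B)).binomExpansion (algebraMap ℂ B b)
      (y j₀ - algebraMap ℂ B b)
    rw [add_sub_cancel, eval_map_algebraMap, derivative_map, eval_map_algebraMap,
      eval_map_algebraMap, aeval_algebraMap_apply, aeval_algebraMap_apply, hyroot,
      coe_aeval_eq_eval, hfb, map_zero, zero_mul, add_zero] at hk
    have : algebraMap ℂ[X] B (X - C t₀) = k * (y j₀ - algebraMap ℂ B b) ^ 2 := by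
      rw [map_sub, hk, IsScalarTower.algebraMap_apply ℂ ℂ[X] B]
      simp [ht₀]
    rw [this]
    exact Ideal.mul_mem_left _ _ (Ideal.pow_mem_pow hj₀ 2)
  obtain ⟨τ, hτ1, hτ⟩ := exists_ne_one_inertia ℂ[X] (RatFunc ℂ) L B p hpbot P hP2
  refine ⟨τ, hτ1, j₀, fun j hj ↦ ?_⟩
  by_contra hτj
  have hτint : IsIntegral ℂ[X] (τ (z j)) := (hzint j).map (τ.restrictScalars ℂ[X])
  obtain ⟨c, hc, hcP⟩ := exists_eval_eq_of_aeval_sub_mem P f hfdeg (x := y j) (t := t₀)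
    (by rw [hyroot]; exact htP)
  let x : B := ⟨τ (z j), hτint⟩
  have hxroot : aeval x f = aeval (y j) f := by
    rw [hyroot]
    apply Subtype.ext
    have h1 : ((aeval x f : B) : L) = aeval (τ (z j)) f := (aeval_algebraMap_apply L x f).symm
    have h2 : aeval (τ (z j)) f = τ (aeval (z j) f) :=
      aeval_algHom_apply (τ.toAlgHom.restrictScalars ℂ) (z j) f
    rw [h1, h2, hroot]
    exact (τ.restrictScalars ℂ[X]).commutes X
  have hder : (derivative f).eval c = 0 :=
    eval_derivative_eq_zero_of_sub_mem P f (fun h ↦ hτj (congrArg Subtype.val h)) hxroot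
      (hτ (y j) x rfl) hcP
  rw [hfdef, derivative_comp, eval_mul, eval_comp, mul_eq_zero] at hder
  obtain hder | hder := hder
  swap
  · exact hmerge.1 ⟨c, b, hder, hb, hc⟩
  have hcb : h.eval c = h.eval b := hmerge.2 c b hder hb (by
    rw [← eval_comp, ← eval_comp]; exact hc)
  have hred : ∀ i (a : ℂ), y i - algebraMap ℂ B a ∈ P →
      aeval (y i) h - algebraMap ℂ B (h.eval a) ∈ P := fun i a ha ↦ by
    obtain ⟨q, hq⟩ := (h.map (algebraMap ℂ B)).evalSubFactor (y i) (algebraMap ℂ B a)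
    rw [eval_map_algebraMap, eval_map_algebraMap, aeval_algebraMap_apply, coe_aeval_eq_eval] at hq
    rw [hq]
    exact P.mul_mem_left _ ha
  have h1 := hred j₀ b hj₀
  have h2 := hred j c hcP
  rw [hcb] at h2
  have h3 : (derivative ftilde).eval (h.eval b) = 0 := by
    refine eval_derivative_eq_zero_of_sub_mem P ftilde (x := aeval (y j) h)
      (y := aeval (y j₀) h) (fun h ↦ hj ?_) ?_ ?_ h1
    · rw [← hy, ← hy, h]
    · rw [← aeval_comp, ← aeval_comp, hyroot, hyroot]
    · have := P.sub_mem h2 h1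
      rwa [sub_sub_sub_cancel_right] at this
  exact hmerge.1 ⟨b, b, h3, hb, rfl⟩

theorem exists_algEquiv_of_splittingField {F L : Type*} [Field F] [Field L] [Algebra F L]
    [Normal F L] (p : F[X]) (hs : (p.map (algebraMap F L)).Splits)
    (h2 : ∀ x y x' y' : p.SplittingField, x ∈ p.aroots p.SplittingField →
      y ∈ p.aroots p.SplittingField → x' ∈ p.aroots p.SplittingField →
      y' ∈ p.aroots p.SplittingField → x ≠ y → x' ≠ y' →
      ∃ σ : p.SplittingField ≃ₐ[F] p.SplittingField, σ x = x' ∧ σ y = y')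
    {x y x' y' : L} (hx : x ∈ p.aroots L) (hy : y ∈ p.aroots L) (hx' : x' ∈ p.aroots L)
    (hy' : y' ∈ p.aroots L) (hxy : x ≠ y) (hxy' : x' ≠ y') :
    ∃ σ : L ≃ₐ[F] L, σ x = x' ∧ σ y = y' := by
  let φ : p.SplittingField →ₐ[F] L := SplittingField.lift p hs
  have hlift : ∀ u ∈ p.aroots L, ∃ u₀ ∈ p.aroots p.SplittingField, φ u₀ = u := fun u hu ↦ by
    have h := (SplittingField.splits p).roots_map (φ : p.SplittingField →+* L)
    rw [Polynomial.map_map, AlgHom.comp_algebraMap] at h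
    rw [aroots_def, h] at hu
    simpa using hu
  obtain ⟨x₀, hx₀, rfl⟩ := hlift x hx
  obtain ⟨y₀, hy₀, rfl⟩ := hlift y hy
  obtain ⟨x₁, hx₁, rfl⟩ := hlift x' hx'
  obtain ⟨y₁, hy₁, rfl⟩ := hlift y' hy'
  obtain ⟨σ, rfl, rfl⟩ := h2 x₀ y₀ x₁ y₁ hx₀ hy₀ hx₁ hy₁ (fun h ↦ hxy (h ▸ rfl))
    (fun h ↦ hxy' (h ▸ rfl))
  let _ : Algebra p.SplittingField L := φ.toRingHom.toAlgebra
  have : IsScalarTower F p.SplittingField L := .of_algebraMap_eq fun a ↦ (φ.commutes a).symm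
  exact ⟨σ.liftNormal L, σ.liftNormal_commutes L x₀, σ.liftNormal_commutes L y₀⟩

theorem exists_ringEquiv_of_splittingField {F L : Type*} [Field F] [Field L] (φ : F →+* L)
    (hn : @Normal F L _ _ φ.toAlgebra) (p : F[X]) (hs : (p.map φ).Splits)
    (h2 : ∀ x y x' y' : p.SplittingField, x ∈ p.aroots p.SplittingField →
      y ∈ p.aroots p.SplittingField → x' ∈ p.aroots p.SplittingField →
      y' ∈ p.aroots p.SplittingField → x ≠ y → x' ≠ y' →
      ∃ σ : p.SplittingField ≃ₐ[F] p.SplittingField, σ x = x' ∧ σ y = y')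
    {x y x' y' : L} (hx : x ∈ (p.map φ).roots) (hy : y ∈ (p.map φ).roots)
    (hx' : x' ∈ (p.map φ).roots) (hy' : y' ∈ (p.map φ).roots) (hxy : x ≠ y) (hxy' : x' ≠ y') :
    ∃ σ : L ≃+* L, (∀ a, σ (φ a) = φ a) ∧ σ x = x' ∧ σ y = y' := by
  let _ := φ.toAlgebra
  obtain ⟨σ, h₁, h₂⟩ := exists_algEquiv_of_splittingField p hs h2 hx hy hx' hy' hxy hxy'
  exact ⟨σ, σ.commutes, h₁, h₂⟩

theorem normal_toAlgebra_of_comp_eq {K F L : Type*} [Field K] [Field F] [Field L] [Algebra K L]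
    [Normal K L] (ψ : K →+* F) (φ : F →+* L) (h : φ.comp ψ = algebraMap K L) :
    @Normal F L _ _ φ.toAlgebra := by
  let _ := ψ.toAlgebra
  let _ := φ.toAlgebra
  have : IsScalarTower K F L := .of_algebraMap_eq' h.symm
  exact Normal.tower_top_of_normal K F L

theorem exists_algEquiv_of_aeval_eq {L : Type*} [Field L] [Algebra ℂ L] [Algebra (RatFunc ℂ) L]
    [IsScalarTower ℂ (RatFunc ℂ) L] [Normal (RatFunc ℂ) L] (ftilde h : ℂ[X])
    (h2t : IsTwoTransitivePoly h) (hdeg : 0 < h.natDegree) {w : L}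
    (hw : aeval w ftilde = algebraMap (RatFunc ℂ) L RatFunc.X)
    (hs : (h.map (algebraMap ℂ L) - C w).Splits) {x y x' y' : L} (hx : aeval x h = w)
    (hy : aeval y h = w) (hx' : aeval x' h = w) (hy' : aeval y' h = w) (hxy : x ≠ y)
    (hxy' : x' ≠ y') : ∃ σ : L ≃ₐ[RatFunc ℂ] L, σ x = x' ∧ σ y = y' := by
  have hα : (algebraMap (RatFunc ℂ) L).comp (algebraMap ℂ[X] (RatFunc ℂ)) =
      (aeval (algebraMap (RatFunc ℂ) L RatFunc.X) : ℂ[X] →ₐ[ℂ] L).toRingHom := by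
    refine Polynomial.ringHom_ext (fun a ↦ ?_) (by simp [RatFunc.algebraMap_X])
    simp [← IsScalarTower.algebraMap_apply, RatFunc.algebraMap_C, ← RatFunc.algebraMap_eq_C]
  have hαinj : Function.Injective
      ((algebraMap (RatFunc ℂ) L).comp (algebraMap ℂ[X] (RatFunc ℂ))) :=
    (algebraMap (RatFunc ℂ) L).injective.comp (IsFractionRing.injective ℂ[X] (RatFunc ℂ))
  have hwt : Function.Injective (aeval w : ℂ[X] →ₐ[ℂ] L).toRingHom := by
    have h1 : Transcendental ℂ (aeval w ftilde) := by
      rw [hw, transcendental_iff_injective]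
      rw [hα] at hαinj
      exact hαinj
    refine transcendental_iff_injective.1 fun hwa ↦ h1 (IsIntegral.isAlgebraic ?_)
    exact adjoin_le_integralClosure hwa.isIntegral (aeval_mem_adjoin_singleton ℂ w)
  let φ : RatFunc ℂ →+* L := IsFractionRing.lift hwt
  have hφ : ∀ p : ℂ[X], φ (algebraMap ℂ[X] (RatFunc ℂ) p) = aeval w p := fun p ↦
    IsFractionRing.lift_algebraMap hwt p
  have hφC : ∀ a : ℂ, φ (RatFunc.C a) = algebraMap ℂ L a := fun a ↦ by
    rw [← RatFunc.algebraMap_C, hφ, aeval_C]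
  let ψ₀ : ℂ[X] →+* RatFunc ℂ := (algebraMap ℂ[X] (RatFunc ℂ)).comp (compRingHom ftilde)
  have hψ₀ : φ.comp ψ₀ = (algebraMap (RatFunc ℂ) L).comp (algebraMap ℂ[X] (RatFunc ℂ)) := by
    rw [hα]
    refine Polynomial.ringHom_ext (fun a ↦ ?_) ?_
    · simp [ψ₀, hφC]
    · simp [ψ₀, hφ, hw]
  have hψinj : Function.Injective ψ₀ := by
    rw [← hψ₀, RingHom.coe_comp] at hαinj
    exact Function.Injective.of_comp hαinj
  let ψ : RatFunc ℂ →+* RatFunc ℂ := IsFractionRing.lift hψinj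
  have hψ : φ.comp ψ = algebraMap (RatFunc ℂ) L := by
    refine IsLocalization.ringHom_ext (nonZeroDivisors ℂ[X]) ?_
    rw [← hψ₀]
    exact RingHom.ext fun p ↦ congrArg φ (IsFractionRing.lift_algebraMap hψinj p)
  have hnorm := normal_toAlgebra_of_comp_eq ψ φ hψ
  have hmap : (fiberPoly h).map φ = h.map (algebraMap ℂ L) - C w := by
    rw [fiberPoly, Polynomial.map_sub, Polynomial.map_map, map_C, ← RatFunc.algebraMap_X, hφ,
      aeval_X]
    congr 2
    ext a
    simp [RatFunc.algebraMap_eq_C, hφC]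
  have hne : h.map (algebraMap ℂ L) - C w ≠ 0 := fun h0 ↦ by
    have := congrArg natDegree h0
    rw [natDegree_sub_C, natDegree_map, natDegree_zero] at this
    omega
  have hmem : ∀ u, aeval u h = w → u ∈ ((fiberPoly h).map φ).roots := fun u hu ↦ by
    rw [hmap, mem_roots hne, IsRoot.def, eval_sub, eval_C, eval_map_algebraMap, hu, sub_self]
  obtain ⟨σ, hσ, h₁, h₂⟩ := exists_ringEquiv_of_splittingField φ hnorm (fiberPoly h)
    (hmap ▸ hs) h2t (hmem x hx) (hmem y hy) (hmem x' hx') (hmem y' hy') hxy hxy'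
  refine ⟨AlgEquiv.ofRingEquiv (f := σ) fun a ↦ ?_, h₁, h₂⟩
  rw [← hψ]
  exact hσ (ψ a)

theorem apply_eq_of_orthogonal_of_twoTransitive {ι : Type*} [Fintype ι]
    (H : Subgroup (Equiv.Perm ι)) (B : Set ι) (hB : ∀ σ ∈ H, ∀ i ∈ B, σ i ∈ B)
    (h2 : ∀ x ∈ B, ∀ y ∈ B, ∀ x' ∈ B, ∀ y' ∈ B, x ≠ y → x' ≠ y' → ∃ σ ∈ H, σ x = x' ∧ σ y = y')
    (n v : ι → ℂ) (hv : v ≠ 0) (hvB : ∀ i ∉ B, v i = 0) (hsum : ∑ i, v i = 0)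
    (hn : ∀ σ ∈ H, ∑ i, n (σ i) * v i = 0) {b c : ι} (hb : b ∈ B) (hc : c ∈ B) : n b = n c := by
  classical
  by_cases hbc : b = c
  · rw [hbc]
  let M : ι → ι → ℂ := fun i j ↦ ∑ σ : H, v (σ.1⁻¹ i) * starRingEnd ℂ (v (σ.1⁻¹ j))
  have hinv : ∀ τ ∈ H, ∀ i j, M (τ i) (τ j) = M i j := fun τ hτ i j ↦ by
    refine Fintype.sum_equiv (Equiv.mulLeft (⟨τ, hτ⟩ : H)⁻¹) _ _ fun σ ↦ ?_
    simp
  have hoff : ∀ i ∈ B, ∀ j ∈ B, ∀ i' ∈ B, ∀ j' ∈ B, i ≠ j → i' ≠ j' → M i j = M i' j' := by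
    intro i hi j hj i' hi' j' hj' hij hij'
    obtain ⟨σ, hσ, rfl, rfl⟩ := h2 i hi j hj i' hi' j' hj' hij hij'
    exact (hinv σ hσ i j).symm
  have hdiag : ∀ i ∈ B, ∀ j ∈ B, M i i = M j j := by
    intro i hi j hj
    by_cases hij : i = j
    · rw [hij]
    obtain ⟨σ, hσ, rfl, -⟩ := h2 i hi j hj j hj i hi hij (Ne.symm hij)
    exact (hinv σ hσ i i).symm
  have hzero : ∀ i ∉ B, ∀ j, M i j = 0 := fun i hi j ↦ Finset.sum_eq_zero fun σ _ ↦ by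
    rw [hvB _ fun h ↦ hi (by simpa using hB σ.1 σ.2 _ h), zero_mul]
  have hrow : ∀ j, ∑ i, M i j = 0 := fun j ↦ by
    rw [Finset.sum_comm]
    refine Finset.sum_eq_zero fun σ _ ↦ ?_
    rw [← Finset.sum_mul, Equiv.sum_comp σ.1⁻¹ v, hsum, zero_mul]
  have hnM : ∀ j, ∑ i, n i * M i j = 0 := fun j ↦ by
    simp_rw [M, Finset.mul_sum]
    rw [Finset.sum_comm]
    refine Finset.sum_eq_zero fun σ _ ↦ ?_
    simp_rw [← mul_assoc]
    rw [← Finset.sum_mul, ← Equiv.sum_comp σ.1]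
    simp [hn σ.1 σ.2]
  obtain ⟨b₀, hb₀⟩ := Function.ne_iff.1 hv
  have hb₀B : b₀ ∈ B := by
    by_contra h
    exact hb₀ (hvB _ h)
  have hpos : M b₀ b₀ ≠ 0 := by
    have h1 : M b₀ b₀ = ((∑ σ : H, Complex.normSq (v (σ.1⁻¹ b₀)) : ℝ) : ℂ) := by
      simp [M, Complex.mul_conj]
    rw [h1, Complex.ofReal_ne_zero]
    refine (Finset.sum_pos' (fun σ _ ↦ Complex.normSq_nonneg _) ⟨1, Finset.mem_univ _, ?_⟩).ne'
    exact Complex.normSq_pos.2 (by simpa using hb₀)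
  have hpq : M b b ≠ M c b := fun heq ↦ by
    have hall : ∀ i ∈ B, M i b₀ = M b₀ b₀ := fun i hi ↦ by
      by_cases hib : i = b₀
      · rw [hib]
      · rw [hoff i hi b₀ hb₀B c hc b hb hib (Ne.symm hbc), ← heq, hdiag b hb b₀ hb₀B]
    have h1 : ∑ i, M i b₀ = (Finset.univ.filter (· ∈ B)).card * M b₀ b₀ := by
      rw [← nsmul_eq_mul, ← Finset.sum_const, Finset.sum_filter]
      refine Finset.sum_congr rfl fun i _ ↦ ?_
      split_ifs with hi
      · exact hall i hi
      · exact hzero i hi b₀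
    rw [hrow, eq_comm, mul_eq_zero, or_iff_left hpos, Nat.cast_eq_zero, Finset.card_eq_zero] at h1
    exact absurd (Finset.mem_filter.2 ⟨Finset.mem_univ _, hb₀B⟩) (h1 ▸ Finset.notMem_empty b₀)
  have hdiff : ∑ i, n i * (M i b - M i c) = 0 := by
    simp_rw [mul_sub]
    rw [Finset.sum_sub_distrib, hnM, hnM, sub_zero]
  rw [Fintype.sum_eq_add b c hbc] at hdiff
  · rw [hdiag c hc b hb, hoff b hb c hc c hc b hb hbc (Ne.symm hbc)] at hdiff
    have : (n b - n c) * (M b b - M c b) = 0 := by linear_combination hdiff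
    exact sub_eq_zero.1 ((mul_eq_zero.1 this).resolve_right (sub_ne_zero.2 hpq))
  · rintro i ⟨hib, hic⟩
    by_cases hi : i ∈ B
    · rw [hoff i hi b hb i hi c hc hib hic, sub_self, mul_zero]
    · rw [hzero i hi, hzero i hi, sub_self, mul_zero]

theorem apply_eq_of_balanced {ι β : Type*} [Fintype ι] (G : Subgroup (Equiv.Perm ι)) (r : ι → β)
    (hr : ∀ σ ∈ G, ∀ i j, r i = r j → r (σ i) = r (σ j))
    (htrans : ∀ i j, ∃ σ ∈ G, σ i = j) (n e : ι → ℂ) (he : Function.Injective e)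
    (hbal : ∀ σ ∈ G, ∑ i, n (σ i) * e i = 0) {τ : Equiv.Perm ι} (hτ : τ ∈ G) (hτ1 : τ ≠ 1)
    (j₀ : ι) (hτj₀ : ∀ j, r j ≠ r j₀ → τ j = j)
    (h2 : ∀ x y x' y', r x = r j₀ → r y = r j₀ → r x' = r j₀ → r y' = r j₀ → x ≠ y → x' ≠ y' →
      ∃ σ ∈ G, σ x = x' ∧ σ y = y')
    {i j : ι} (hij : r i = r j) : n i = n j := by
  let H : Subgroup (Equiv.Perm ι) :=
    { carrier := {σ | σ ∈ G ∧ r (σ j₀) = r j₀}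
      one_mem' := ⟨G.one_mem, rfl⟩
      mul_mem' := fun {a b} ha hb ↦
        ⟨G.mul_mem ha.1 hb.1, (hr a ha.1 _ _ hb.2).trans ha.2⟩
      inv_mem' := fun {a} ha ↦ ⟨G.inv_mem ha.1, by
        simpa using (hr a⁻¹ (G.inv_mem ha.1) _ _ ha.2).symm⟩ }
  let v : ι → ℂ := fun i ↦ e i - e (τ⁻¹ i)
  have key : ∀ ρ ∈ G, ∀ k, r k = r j₀ → n (ρ j₀) = n (ρ k) := fun ρ hρ k hk ↦ by
    refine apply_eq_of_orthogonal_of_twoTransitive H {i | r i = r j₀}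
      (fun σ hσ i hi ↦ (hr σ hσ.1 _ _ hi).trans hσ.2) ?_ (fun i ↦ n (ρ i)) v ?_ ?_ ?_ ?_ rfl hk
    · intro x hx y hy x' hx' y' hy' hxy hxy'
      obtain ⟨σ, hσ, h₁, h₂⟩ := h2 x y x' y' hx hy hx' hy' hxy hxy'
      exact ⟨σ, ⟨hσ, by rw [← hr σ hσ _ _ hx, h₁]; exact hx'⟩, h₁, h₂⟩
    · intro h0
      refine hτ1 (Equiv.ext fun i ↦ he ?_)
      have := congrFun h0 (τ i)
      simpa [v, sub_eq_zero] using this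
    · intro i hi
      have : τ⁻¹ i = i := by rw [Equiv.Perm.inv_eq_iff_eq, hτj₀ i hi]
      simp only [v]
      rw [this, sub_self]
    · simp only [v]
      rw [Finset.sum_sub_distrib, Equiv.sum_comp τ⁻¹ e, sub_self]
    · intro σ hσ
      simp only [v, mul_sub]
      rw [Finset.sum_sub_distrib, ← Equiv.sum_comp τ (fun i ↦ n (ρ (σ i)) * e (τ⁻¹ i))]
      have h1 := hbal (ρ * σ) (G.mul_mem hρ hσ.1)
      have h2 := hbal (ρ * σ * τ) (G.mul_mem (G.mul_mem hρ hσ.1) hτ)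
      simp only [Equiv.Perm.mul_apply] at h1 h2
      simp [h1, h2]
  obtain ⟨ρ, hρ, rfl⟩ := htrans j₀ i
  have := key ρ hρ (ρ⁻¹ j) (by simpa using (hr ρ⁻¹ (G.inv_mem hρ) _ _ hij).symm)
  simpa using this

theorem Multiset.sum_map_pow_eq_esymm_sub_sum {R : Type*} [CommRing R] (s : Multiset R) {k : ℕ}
    (hk : 0 < k) : (s.map (· ^ k)).sum = (-1) ^ (k + 1) * k * s.esymm k -
      ∑ a ∈ Finset.HasAntidiagonal.antidiagonal k with a.1 ∈ Set.Ioo 0 k,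
        (-1) ^ a.1 * s.esymm a.1 * (s.map (· ^ a.2)).sum := by
  classical
  have hs : Finset.univ.val.map (fun x : s ↦ x.1) = s := Multiset.map_univ_coe s
  have hpsum : ∀ j, MvPolynomial.aeval (fun x : s ↦ x.1) (MvPolynomial.psum s R j) =
      (s.map (· ^ j)).sum := fun j ↦ by
    conv_rhs => rw [← hs, Multiset.map_map]
    rw [MvPolynomial.psum, map_sum]
    simp_rw [map_pow, MvPolynomial.aeval_X]
    rfl
  have := congrArg (MvPolynomial.aeval fun x : s ↦ x.1)
    (MvPolynomial.psum_eq_mul_esymm_sub_sum s R k hk)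
  simpa only [map_sub, map_mul, map_sum, map_pow, map_neg, map_one, map_natCast, hpsum,
    MvPolynomial.aeval_esymm_eq_multiset_esymm, hs] using this

theorem Multiset.sum_map_pow_eq_of_esymm_eq {R : Type*} [CommRing R] {s t : Multiset R}
    (hst : s.card = t.card) {i : ℕ} (h : ∀ k ≤ i, s.esymm k = t.esymm k) :
    (s.map (· ^ i)).sum = (t.map (· ^ i)).sum := by
  induction i using Nat.strong_induction_on with
  | _ i ih =>
    obtain rfl | hi := i.eq_zero_or_pos
    · simp [hst]
    rw [Multiset.sum_map_pow_eq_esymm_sub_sum s hi, Multiset.sum_map_pow_eq_esymm_sub_sum t hi,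
      h i le_rfl]
    congr 1
    refine Finset.sum_congr rfl fun a ha ↦ ?_
    simp only [Finset.mem_filter, Finset.HasAntidiagonal.mem_antidiagonal, Set.mem_Ioo] at ha
    rw [h a.1 (by omega), ih a.2 (by omega) fun k hk ↦ h k (by omega)]

theorem sum_map_pow_roots_eq_of_coeff_eq {L : Type*} [Field L] {p q : L[X]}
    (hp : p.Splits) (hq : q.Splits) (hdeg : p.natDegree = q.natDegree)
    (hcoeff : ∀ k, k ≠ 0 → p.coeff k = q.coeff k) {i : ℕ} (hi : i < p.natDegree) :
    (p.roots.map (· ^ i)).sum = (q.roots.map (· ^ i)).sum := by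
  have hlead : p.leadingCoeff = q.leadingCoeff := by
    rw [leadingCoeff, hcoeff _ (by omega), hdeg, leadingCoeff]
  have hp0 : p.leadingCoeff ≠ 0 := leadingCoeff_ne_zero.2 fun h ↦ by simp [h] at hi
  refine Multiset.sum_map_pow_eq_of_esymm_eq
    (by rw [← hp.natDegree_eq_card_roots, ← hq.natDegree_eq_card_roots, hdeg]) fun k hk ↦ ?_
  have := hcoeff (p.natDegree - k) (by omega)
  rw [coeff_eq_esymm_roots_of_splits hp (Nat.sub_le _ _),
    coeff_eq_esymm_roots_of_splits hq (by omega), ← hlead, ← hdeg,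
    Nat.sub_sub_self (by omega)] at this
  exact mul_left_cancel₀ (mul_ne_zero hp0 (pow_ne_zero _ (by simp))) this

theorem algebraMap_sum_map_pow_roots_sub_C {L : Type*} [Field L] [Algebra ℂ L] {h : ℂ[X]} {w : L}
    (hs : (h.map (algebraMap ℂ L) - C w).Splits) {i : ℕ} (hi : i < h.natDegree) :
    algebraMap ℂ L (((h - C 0).roots.map (· ^ i)).sum) =
      ((h.map (algebraMap ℂ L) - C w).roots.map (· ^ i)).sum := by
  have hh := (IsAlgClosed.splits h).roots_map (algebraMap ℂ L)
  rw [sum_map_pow_roots_eq_of_coeff_eq hs ((IsAlgClosed.splits h).map (algebraMap ℂ L)) (by simp)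
    (fun k hk ↦ by simp [coeff_C, hk]) (by simpa using hi), hh, map_multiset_sum]
  simp

theorem Polynomial.Monic.roots_eq_map_of_injective {L ι : Type*} [Field L] [Fintype ι] {p : L[X]}
    (hp : p.Monic) (hcard : p.natDegree = Fintype.card ι) {z : ι → L} (hz : Function.Injective z)
    (hroot : ∀ i, p.IsRoot (z i)) : p.roots = Finset.univ.val.map z := by
  refine (Multiset.eq_of_le_of_card_le ?_ ?_).symm
  · refine (Multiset.le_iff_subset (Finset.univ.nodup.map hz)).2 fun x hx ↦ ?_
    obtain ⟨i, -, rfl⟩ := Multiset.mem_map.1 hx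
    exact (mem_roots hp.ne_zero).2 (hroot i)
  · simpa [← hcard] using p.card_roots'

theorem Polynomial.Monic.eq_prod_X_sub_C_of_injective {L ι : Type*} [Field L] [Fintype ι]
    {p : L[X]} (hp : p.Monic) (hcard : p.natDegree = Fintype.card ι) {z : ι → L}
    (hz : Function.Injective z) (hroot : ∀ i, p.IsRoot (z i)) : p = ∏ i, (X - C (z i)) := by
  have h := hp.roots_eq_map_of_injective hcard hz hroot
  rw [← prod_multiset_X_sub_C_of_monic_of_roots_card_eq hp (by simp [h, hcard]), h,
    Multiset.map_map]
  rfl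

theorem map_sub_C_dvd_map_comp_sub_C {k L : Type*} [Field k] [Field L] [Algebra k L]
    (ftilde h : k[X]) {w t : L} (hw : aeval w ftilde = t) :
    h.map (algebraMap k L) - C w ∣ (ftilde.comp h).map (algebraMap k L) - C t := by
  have h1 : X - C w ∣ ftilde.map (algebraMap k L) - C t := by
    rw [dvd_iff_isRoot, IsRoot.def, eval_sub, eval_C, eval_map_algebraMap, hw, sub_self]
  obtain ⟨q, hq⟩ := h1
  refine ⟨q.comp (h.map (algebraMap k L)), ?_⟩
  have := congrArg (fun p ↦ p.comp (h.map (algebraMap k L))) hq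
  simpa [Polynomial.map_comp] using this

theorem splits_map_sub_C_of_eq_prod {k L ι : Type*} [Field k] [Field L] [Algebra k L] [Fintype ι]
    {ftilde h : k[X]} {t : L} {z : ι → L}
    (hprod : (ftilde.comp h).map (algebraMap k L) - C t = ∏ i, (X - C (z i))) {w : L}
    (hw : aeval w ftilde = t) : (h.map (algebraMap k L) - C w).Splits :=
  Splits.of_dvd (hprod ▸ .prod fun _ _ ↦ .X_sub_C _)
    (hprod ▸ (monic_prod_X_sub_C z Finset.univ).ne_zero) (map_sub_C_dvd_map_comp_sub_C ftilde h hw)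

theorem roots_map_sub_C_eq_map_filter {k L ι : Type*} [Field k] [Field L] [Algebra k L]
    [Fintype ι] [DecidableEq L] {ftilde h : k[X]} {t : L} {z : ι → L} (hz : Function.Injective z)
    (hprod : (ftilde.comp h).map (algebraMap k L) - C t = ∏ i, (X - C (z i)))
    {w : L} (hw : aeval w ftilde = t) :
    (h.map (algebraMap k L) - C w).roots =
      (Finset.univ.filter fun i ↦ aeval (z i) h = w).val.map z := by
  have hne : (ftilde.comp h).map (algebraMap k L) - C t ≠ 0 :=
    hprod ▸ (monic_prod_X_sub_C z Finset.univ).ne_zero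
  have hdvd := map_sub_C_dvd_map_comp_sub_C ftilde h hw
  have hle : (h.map (algebraMap k L) - C w).roots ≤ Finset.univ.val.map z := by
    have := roots.le_of_dvd hne hdvd
    rw [← roots_multiset_prod_X_sub_C (Finset.univ.val.map z), Multiset.map_map]
    rw [hprod] at this
    exact this
  refine (Multiset.Nodup.ext (Multiset.nodup_of_le hle (Finset.univ.nodup.map hz))
    ((Finset.nodup _).map hz)).2 fun x ↦ ⟨fun hx ↦ ?_, fun hx ↦ ?_⟩
  · obtain ⟨i, -, rfl⟩ := Multiset.mem_map.1 (Multiset.mem_of_le hle hx)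
    have := isRoot_of_mem_roots hx
    rw [IsRoot.def, eval_sub, eval_C, eval_map_algebraMap, sub_eq_zero] at this
    exact Multiset.mem_map_of_mem z (by simpa using this)
  · obtain ⟨i, hi, rfl⟩ := Multiset.mem_map.1 hx
    rw [mem_roots (ne_zero_of_dvd_ne_zero hne hdvd), IsRoot.def, eval_sub, eval_C,
      eval_map_algebraMap, sub_eq_zero]
    simpa using hi

theorem exists_perm_of_algEquiv {K L ι : Type*} [Field K] [Field L] [Algebra K L] [Finite ι]
    {p : K[X]} {z : ι → L} (hz : Function.Injective z)
    (hp : ∀ x, aeval x p = 0 ↔ ∃ i, z i = x) (σ : L ≃ₐ[K] L) :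
    ∃ π : Equiv.Perm ι, ∀ i, σ (z i) = z (π i) := by
  have h : ∀ i, ∃ j, z j = σ (z i) := fun i ↦ by
    rw [← hp, aeval_algHom_apply σ, (hp _).2 ⟨i, rfl⟩, map_zero]
  choose π hπ using h
  have hinj : Function.Injective π := fun i j hij ↦ hz (σ.injective (by rw [← hπ, ← hπ, hij]))
  exact ⟨Equiv.ofBijective π (Finite.injective_iff_bijective.1 hinj), fun i ↦ (hπ i).symm⟩

/-- The permutations of the index set of a family `z` induced by automorphisms of `L / K`. -/
def inducedPermSubgroup {K L ι : Type*} [Field K] [Field L] [Algebra K L] (z : ι → L) :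
    Subgroup (Equiv.Perm ι) where
  carrier := {π | ∃ σ : L ≃ₐ[K] L, ∀ i, σ (z i) = z (π i)}
  one_mem' := ⟨1, fun _ ↦ rfl⟩
  mul_mem' := by
    rintro π ρ ⟨σ, hσ⟩ ⟨τ, hτ⟩
    exact ⟨σ * τ, fun i ↦ by rw [AlgEquiv.mul_apply, hτ, hσ, Equiv.Perm.mul_apply]⟩
  inv_mem' := by
    rintro π ⟨σ, hσ⟩
    refine ⟨σ⁻¹, fun i ↦ ?_⟩
    rw [AlgEquiv.aut_inv, AlgEquiv.symm_apply_eq, hσ]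
    simp

theorem coeff_eq_of_balanced {L : Type} [Field L] [Algebra ℂ L] [Algebra (RatFunc ℂ) L]
    [IsScalarTower ℂ (RatFunc ℂ) L] (m : ℕ) (ftilde h : ℂ[X]) (hf : (ftilde.comp h).Monic)
    (hdeg : 1 < h.natDegree) (hm : 0 < m)
    (hsplit : IsSplittingField (RatFunc ℂ) L (fiberPoly (ftilde.comp h)))
    (z : Fin m → L) (hzinj : Function.Injective z)
    (hprod : (ftilde.comp h).map (algebraMap ℂ L) - C (algebraMap (RatFunc ℂ) L RatFunc.X) =
      ∏ i, (X - C (z i)))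
    (σinf : L ≃ₐ[RatFunc ℂ] L)
    (hσinf : ∀ i : Fin m, σinf (z i) = z ⟨((i : ℕ) + 1) % m, Nat.mod_lt _ hm⟩)
    (ε : ℂ) (hε : IsPrimitiveRoot ε m) (n : Fin m → ℤ)
    (hbal : ∀ (σ : L ≃ₐ[RatFunc ℂ] L) (π : Equiv.Perm (Fin m)),
      (∀ i : Fin m, σ (z i) = z (π i)) →
      ∑ i : Fin m, ((n (π i) : ℂ)) * ε ^ ((i : ℕ) + 1) = 0)
    (hmerge : CriticalValuesDoNotMerge ftilde h) (h2t : IsTwoTransitivePoly h)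
    {i j : Fin m} (hij : aeval (z i) h = aeval (z j) h) : n i = n j := by
  have hfin : FiniteDimensional (RatFunc ℂ) L :=
    IsSplittingField.finiteDimensional L (fiberPoly (ftilde.comp h))
  have hnorm : Normal (RatFunc ℂ) L := Normal.of_isSplittingField (fiberPoly (ftilde.comp h))
  have hgal : IsGalois (RatFunc ℂ) L := ⟨⟩
  have hfdeg : (ftilde.comp h).natDegree = m := by
    have := congrArg natDegree hprod
    rwa [natDegree_sub_C, natDegree_map, natDegree_finsetProd_X_sub_C_eq_card,
      Finset.card_univ, Fintype.card_fin] at this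
  have hmap : (fiberPoly (ftilde.comp h)).map (algebraMap (RatFunc ℂ) L) =
      ∏ i, (X - C (z i)) := by
    rw [← hprod, fiberPoly, Polynomial.map_sub, Polynomial.map_map, map_C,
      ← IsScalarTower.algebraMap_eq]
  have hroot : ∀ x : L, aeval x (fiberPoly (ftilde.comp h)) = 0 ↔ ∃ i, z i = x := fun x ↦ by
    rw [← eval_map_algebraMap, hmap, eval_prod, Finset.prod_eq_zero_iff]
    simp [sub_eq_zero, eq_comm]
  have hw : ∀ i, aeval (aeval (z i) h) ftilde = algebraMap (RatFunc ℂ) L RatFunc.X := fun i ↦ by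
    have := congrArg (eval (z i)) hprod
    rwa [eval_prod, Finset.prod_eq_zero (Finset.mem_univ i) (by simp), eval_sub, eval_C,
      eval_map_algebraMap, sub_eq_zero, aeval_comp] at this
  obtain ⟨τ, hτ1, j₀, hτ⟩ := exists_automorphism_moving_one_fiber ftilde h hf hdeg
    (hfdeg ▸ hm) hmerge z hprod
  obtain ⟨π, hπ⟩ := exists_perm_of_algEquiv hzinj hroot τ
  have hlift : ∀ σ : L ≃ₐ[RatFunc ℂ] L, ∃ ρ ∈ inducedPermSubgroup (K := RatFunc ℂ) z,
      ∀ i, σ (z i) = z (ρ i) := fun σ ↦ by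
    obtain ⟨ρ, hρ⟩ := exists_perm_of_algEquiv hzinj hroot σ
    exact ⟨ρ, ⟨σ, hρ⟩, hρ⟩
  have hcyc : ∀ (i : Fin m) (k : ℕ),
      (σinf ^ k) (z i) = z ⟨((i : ℕ) + k) % m, Nat.mod_lt _ hm⟩ := fun i k ↦ by
    induction k with
    | zero => simp [Nat.mod_eq_of_lt i.2]
    | succ k ih => simp [pow_succ', AlgEquiv.mul_apply, ih, hσinf, add_assoc]
  have hfib : ∀ (σ : L ≃ₐ[RatFunc ℂ] L) (x : L), aeval (σ x) h = σ (aeval x h) := fun σ x ↦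
    aeval_algHom_apply ((σ : L →ₐ[RatFunc ℂ] L).restrictScalars ℂ) x h
  have key := apply_eq_of_balanced (inducedPermSubgroup (K := RatFunc ℂ) z)
    (fun i ↦ aeval (z i) h) ?_ ?_ (fun i ↦ (n i : ℂ)) (fun i ↦ ε ^ ((i : ℕ) + 1)) ?_ ?_
    (τ := π) ⟨τ, hπ⟩ ?_ j₀ ?_ ?_ hij
  · exact_mod_cast key
  · rintro ρ ⟨σ, hσ⟩ a b hab
    simp only [← hσ, hfib, hab]
  · intro a b
    obtain ⟨ρ, hρ, hσ⟩ := hlift (σinf ^ ((m - a) + b))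
    refine ⟨ρ, hρ, hzinj ?_⟩
    rw [← hσ, hcyc]
    congr 1
    ext
    simp only
    rw [← add_assoc, Nat.add_sub_cancel' a.2.le, Nat.add_mod_left, Nat.mod_eq_of_lt b.2]
  · intro a b hab
    have hε0 : ε ≠ 0 := hε.ne_zero hm.ne'
    simp only [pow_succ] at hab
    exact Fin.ext (hε.pow_inj a.2 b.2 (mul_right_cancel₀ hε0 hab))
  · rintro ρ ⟨σ, hσ⟩
    exact hbal σ ρ hσ
  · rintro rfl
    refine hτ1 (AlgEquiv.coe_toAlgHom_injective ?_)
    refine AlgHom.ext_of_adjoin_eq_top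
      (IsSplittingField.adjoin_rootSet L (fiberPoly (ftilde.comp h))) fun x hx ↦ ?_
    obtain ⟨a, rfl⟩ := (hroot x).1 (aeval_eq_zero_of_mem_rootSet hx)
    simpa using hπ a
  · exact fun a ha ↦ hzinj (by rw [← hπ, hτ a ha])
  · intro a b a' b' ha hb ha' hb' hab hab'
    obtain ⟨σ, h₁, h₂⟩ := exists_algEquiv_of_aeval_eq ftilde h h2t (by omega) (hw j₀)
      (splits_map_sub_C_of_eq_prod hprod (hw j₀)) ha hb ha' hb' (hzinj.ne hab) (hzinj.ne hab')
    obtain ⟨ρ, hρ, hσ⟩ := hlift σ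
    exact ⟨ρ, hρ, hzinj (by rw [← hσ, h₁]), hzinj (by rw [← hσ, h₂])⟩

theorem sum_filter_aeval_eq {L ι : Type*} [Field L] [Algebra ℂ L] [Fintype ι] [DecidableEq L]
    {ftilde h : ℂ[X]} {t : L} {z : ι → L} (hz : Function.Injective z)
    (hprod : (ftilde.comp h).map (algebraMap ℂ L) - C t = ∏ i, (X - C (z i)))
    {s : ℕ → ℂ} (hs : ∀ i < h.natDegree, s i = ((h - C 0).roots.map (· ^ i)).sum)
    (g₀ : ℕ → ℂ[X]) {w : L} (hw : aeval w ftilde = t) :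
    ∑ i with aeval (z i) h = w,
        aeval (z i) (∑ k ∈ Finset.range h.natDegree, X ^ k * (g₀ k).comp h) =
      aeval w (∑ k ∈ Finset.range h.natDegree, C (s k) * g₀ k) := by
  have hsplits := splits_map_sub_C_of_eq_prod hprod hw
  simp only [map_sum, map_mul, map_pow, aeval_X, aeval_C]
  rw [Finset.sum_comm]
  refine Finset.sum_congr rfl fun k hk ↦ ?_
  rw [hs k (Finset.mem_range.1 hk),
    algebraMap_sum_map_pow_roots_sub_C hsplits (Finset.mem_range.1 hk),
    roots_map_sub_C_eq_map_filter hz hprod hw, Multiset.map_map]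
  change _ = (∑ i with aeval (z i) h = w, z i ^ k) * _
  rw [Finset.sum_mul]
  refine Finset.sum_congr rfl fun i hi ↦ ?_
  rw [aeval_comp, (Finset.mem_filter.1 hi).2]

theorem card_filter_aeval_eq {L ι : Type*} [Field L] [Algebra ℂ L] [Fintype ι] [DecidableEq L]
    {ftilde h : ℂ[X]} {t : L} {z : ι → L} (hz : Function.Injective z)
    (hprod : (ftilde.comp h).map (algebraMap ℂ L) - C t = ∏ i, (X - C (z i)))
    {w : L} (hw : aeval w ftilde = t) :
    (Finset.univ.filter fun i ↦ aeval (z i) h = w).card = h.natDegree := by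
  have := (splits_map_sub_C_of_eq_prod hprod hw).natDegree_eq_card_roots
  rw [roots_map_sub_C_eq_map_filter hz hprod hw, natDegree_sub_C, natDegree_map,
    Multiset.card_map] at this
  exact this.symm

theorem mul_sum_eq_sum_of_const_on_fibers {ι β R : Type*} [CommSemiring R] [Fintype ι]
    [DecidableEq β] (r : ι → β) (n a b : ι → R) (d : ℕ) (hn : ∀ i j, r i = r j → n i = n j)
    (hcard : ∀ j, (Finset.univ.filter fun i ↦ r i = r j).card = d)
    (hab : ∀ j, ∑ i with r i = r j, a i = b j) :
    d * ∑ j, n j * a j = ∑ j, n j * b j := by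
  simp_rw [← hab, Finset.mul_sum, Finset.sum_filter]
  rw [Finset.sum_comm]
  refine Finset.sum_congr rfl fun i _ ↦ ?_
  rw [← Finset.sum_filter, ← hcard i, ← nsmul_eq_mul, ← Finset.sum_const]
  refine Finset.sum_congr (by simp [eq_comm]) fun j hj ↦ ?_
  rw [hn i j (by simpa [eq_comm] using hj)]

/-- for `f = f̃ ∘ h` with `h` 2-transitive, non-merging critical values and a
balanced 0-cycle `C = (n_1, …, n_m)` of `f`, and `g(X) = ∑_{i<d} X^i gᵢ(h(X))`:
`∫_C g = 0` iff `∫_C g̃ ∘ h = 0`, where `g̃ = ∑_{i<d} sᵢ gᵢ` and `s_i` are the power sums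
of the roots of `h(X) - w` (independent of `w`). -/
theorem stmt_8 (m d : ℕ) (f ftilde h : Polynomial ℂ)
    (hf : f.Monic) (hcomp : f = ftilde.comp h)
    (hd : h.natDegree = d) (hd1 : 1 < d) (hm : f.natDegree = m) (hdm : d < m)
    (L : Type) [Field L] [Algebra ℂ L] [Algebra (RatFunc ℂ) L]
    [IsScalarTower ℂ (RatFunc ℂ) L]
    (hsplit : Polynomial.IsSplittingField (RatFunc ℂ) L
      (f.map (algebraMap ℂ (RatFunc ℂ)) - Polynomial.C RatFunc.X))
    (z : Fin m → L) (hzinj : Function.Injective z)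
    (hzroot : ∀ i : Fin m,
      Polynomial.aeval (z i) f = algebraMap (RatFunc ℂ) L RatFunc.X)
    (σinf : L ≃ₐ[RatFunc ℂ] L)
    (hσinf : ∀ i : Fin m, σinf (z i) = z ⟨((i : ℕ) + 1) % m, Nat.mod_lt _ (by omega)⟩)
    (ε : ℂ) (hε : IsPrimitiveRoot ε m)
    (n : Fin m → ℤ) (hcycle : ∑ i : Fin m, n i = 0)
    (hbal : ∀ (σ : L ≃ₐ[RatFunc ℂ] L) (π : Equiv.Perm (Fin m)),
      (∀ i : Fin m, σ (z i) = z (π i)) →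
      ∑ i : Fin m, ((n (π i) : ℂ)) * ε ^ ((i : ℕ) + 1) = 0)
    (hmerge : CriticalValuesDoNotMerge ftilde h)
    (h2t : IsTwoTransitivePoly h)
    (s : ℕ → ℂ)
    (hs : ∀ (w : ℂ), ∀ i < d,
      s i = (((h - Polynomial.C w).roots).map (fun z => z ^ i)).sum)
    (g₀ : ℕ → Polynomial ℂ) (g gt : Polynomial ℂ)
    (hg : g = ∑ i ∈ Finset.range d, Polynomial.X ^ i * (g₀ i).comp h)
    (hgt : gt = ∑ i ∈ Finset.range d, Polynomial.C (s i) * g₀ i) :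
    (∑ j : Fin m, algebraMap ℂ L ((n j : ℂ)) * Polynomial.aeval (z j) g = 0) ↔
      (∑ j : Fin m, algebraMap ℂ L ((n j : ℂ)) *
        Polynomial.aeval (z j) (gt.comp h) = 0) := by
  classical
  subst hcomp hd hg hgt
  have hm0 : 0 < m := by omega
  have hprod : (ftilde.comp h).map (algebraMap ℂ L) -
      C (algebraMap (RatFunc ℂ) L RatFunc.X) = ∏ i, (X - C (z i)) := by
    have hdeg : ((ftilde.comp h).map (algebraMap ℂ L)).natDegree = m := by rw [natDegree_map, hm]
    refine Monic.eq_prod_X_sub_C_of_injective ((hf.map _).sub_of_left ?_) ?_ hzinj fun i ↦ ?_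
    · exact degree_C_le.trans_lt (natDegree_pos_iff_degree_pos.1 (hdeg ▸ hm0))
    · rw [natDegree_sub_C, hdeg, Fintype.card_fin]
    · rw [IsRoot.def, eval_sub, eval_C, eval_map_algebraMap, hzroot, sub_self]
  have hw : ∀ i, aeval (aeval (z i) h) ftilde = algebraMap (RatFunc ℂ) L RatFunc.X := fun i ↦ by
    rw [← aeval_comp, hzroot]
  have key := mul_sum_eq_sum_of_const_on_fibers (fun i ↦ aeval (z i) h)
    (fun i ↦ algebraMap ℂ L (n i)) _ _ h.natDegree
    (fun i j hij ↦ by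
      rw [coeff_eq_of_balanced m ftilde h hf hd1 hm0 hsplit z hzinj hprod σinf hσinf ε hε n hbal
        hmerge h2t hij])
    (fun j ↦ card_filter_aeval_eq hzinj hprod (hw j))
    (fun j ↦ sum_filter_aeval_eq hzinj hprod (hs 0) g₀ (hw j))
  have hd0 : (h.natDegree : L) ≠ 0 := by
    have := charZero_of_injective_algebraMap (algebraMap ℂ L).injective
    exact Nat.cast_ne_zero.2 (by omega)
  simp_rw [aeval_comp]
  rw [← key, mul_eq_zero, or_iff_right hd0]
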